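/- Let φ₀, φ₁ : ℝⁿ → ℝ be smooth ℤⁿ-periodic functions such that u₀ = ½|x|² + φ₀ and u₁ = ½|x|² + φ₁ both have positive definite Hessians, and let A : ℝⁿ → ℝ be smooth and ℤⁿ-periodic. For t ∈ [0,1] set φ_t = (1−t)φ₀ + tφ₁, u_t = ½|x|² + φ_t, ψ = φ₁ − φ₀, and define F_A(φ_t) = ∫_{[0,1]ⁿ} (−log det(Hess u_t) + A φ_t) dx. Then the second derivative of t ↦ F_A(φ_t) equals ∫_{[0,1]ⁿ} Σ_{i,j,a,b} (u_t)^{ia} ψ_{ab} (u_t)^{bj} ψ_{ij} dx, which is nonnegative; in particular t ↦ F_A(φ_t) is convex on [0,1]. -/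

import Mathlib

open MeasureTheory Matrix

/-- Partial derivative in the `i`-th coordinate direction. -/
noncomputable def pd {n : ℕ} (i : Fin n) (f : (Fin n → ℝ) → ℝ) (x : Fin n → ℝ) : ℝ :=
  fderiv ℝ f x (Pi.single i 1)

/-- Hessian matrix `(u_{ij})` of `u` at `x`. -/
noncomputable def hess {n : ℕ} (u : (Fin n → ℝ) → ℝ) (x : Fin n → ℝ) :
    Matrix (Fin n) (Fin n) ℝ :=
  Matrix.of fun i j => pd i (pd j u) x

/-- `f : ℝⁿ → ℝ` is ℤⁿ-periodic. -/
def ZPer {n : ℕ} (f : (Fin n → ℝ) → ℝ) : Prop :=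
  ∀ (x : Fin n → ℝ) (k : Fin n → ℤ), f (x + fun i => (k i : ℝ)) = f x

/-- Abreu's operator `∑_{i,j} ∂²u^{ij}/∂x_i∂x_j`, where `(u^{ij})` is the inverse Hessian. -/
noncomputable def abreuOp {n : ℕ} (u : (Fin n → ℝ) → ℝ) (x : Fin n → ℝ) : ℝ :=
  ∑ i, ∑ j, pd i (pd j (fun z => (hess u z)⁻¹ i j)) x

/-- Differentiation under the integral sign over a compact set, for a jointly continuous
derivative. -/
lemma hasDerivAt_setIntegral_of_continuousOn {X : Type*} [TopologicalSpace X]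
    [MeasurableSpace X] [OpensMeasurableSpace X] [SecondCountableTopology X] [T2Space X]
    {μ : Measure X} [IsFiniteMeasureOnCompacts μ] {S : Set ℝ} {K : Set X} (hS : IsOpen S)
    (hK : IsCompact K) {f f' : ℝ → X → ℝ}
    (hf : ContinuousOn (fun p : ℝ × X => f p.1 p.2) (S ×ˢ K))
    (hf' : ContinuousOn (fun p : ℝ × X => f' p.1 p.2) (S ×ˢ K))
    (hd : ∀ t ∈ S, ∀ x ∈ K, HasDerivAt (fun s => f s x) (f' t x) t) {t : ℝ} (ht : t ∈ S) :
    HasDerivAt (fun s => ∫ x in K, f s x ∂μ) (∫ x in K, f' t x ∂μ) t := by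
  have slice : ∀ {g : ℝ → X → ℝ}, ContinuousOn (fun p : ℝ × X => g p.1 p.2) (S ×ˢ K) →
      ∀ s ∈ S, ContinuousOn (g s) K := fun hg s hs =>
    hg.comp (f := fun x => (s, x)) (by fun_prop) fun x hx => ⟨hs, hx⟩
  obtain ⟨ε, hε, hεS⟩ := Metric.nhds_basis_closedBall.mem_iff.1 (hS.mem_nhds ht)
  obtain ⟨C, hC⟩ := ((isCompact_closedBall t ε).prod hK).exists_bound_of_continuousOn
    (hf'.mono (Set.prod_mono_left hεS))
  have : IsFiniteMeasure (μ.restrict K) := ⟨by simpa using hK.measure_lt_top⟩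
  refine (hasDerivAt_integral_of_dominated_loc_of_deriv_le (bound := fun _ => C)
    (Metric.closedBall_mem_nhds t hε) ?_ ?_ ?_ ?_ (integrable_const C) ?_).2
  · filter_upwards [hS.mem_nhds ht] with s hs
    exact (slice hf s hs).aestronglyMeasurable hK.measurableSet
  · exact (slice hf t ht).integrableOn_compact hK
  · exact (slice hf' t ht).aestronglyMeasurable hK.measurableSet
  · exact ae_restrict_of_forall_mem hK.measurableSet fun x hx s hs => hC (s, x) ⟨hs, hx⟩
  · exact ae_restrict_of_forall_mem hK.measurableSet fun x hx s hs => hd s (hεS hs) x hx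

lemma hasDerivAt_of_eq_add_sub_mul {g h : ℝ → ℝ} {t : ℝ}
    (hg : ∀ᶠ s in nhds t, g s = g t + (s - t) * h s) (hh : ContinuousAt h t) :
    HasDerivAt g (h t) t := by
  rw [hasDerivAt_iff_tendsto_slope]
  refine (hh.tendsto.mono_left nhdsWithin_le_nhds).congr' ?_
  filter_upwards [nhdsWithin_le_nhds hg, self_mem_nhdsWithin] with s hs hne
  have : s - t ≠ 0 := sub_ne_zero.2 hne
  rw [slope_def_field, hs]
  field_simp
  ring

lemma lineMap_eq_add_smul {m : Type*} (M N : Matrix m m ℝ) (s t : ℝ) :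
    (1 - s) • M + s • N = ((1 - t) • M + t • N) + (s - t) • (N - M) := by
  module

lemma sum_mul_mul_mul_eq_trace {m : Type*} [Fintype m] {P D : Matrix m m ℝ} (hD : D.IsHermitian) :
    ∑ i, ∑ j, ∑ a, ∑ b, P i a * D a b * P b j * D i j = (P * D * P * D).trace := by
  have hD' : ∀ i j, D i j = D j i := fun i j => by simpa using (hD.apply i j).symm
  simp only [trace, diag_apply, mul_apply, Finset.sum_mul]
  refine Finset.sum_congr rfl fun i _ => Finset.sum_congr rfl fun j _ => ?_
  rw [Finset.sum_comm, hD' i j]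

section MatrixPath

variable {m : Type*} [Fintype m] [DecidableEq m]

lemma ContinuousOn.matrix_inv {X : Type*} [TopologicalSpace X] {M : X → Matrix m m ℝ}
    {s : Set X} (hM : ContinuousOn M s) (h0 : ∀ x ∈ s, (M x).det ≠ 0) :
    ContinuousOn (fun x => (M x)⁻¹) s := by
  simp only [Matrix.inv_def, Ring.inverse_eq_inv']
  have hdet : ContinuousOn (fun x => (M x).det) s :=
    (Continuous.matrix_det continuous_id).comp_continuousOn hM
  have hadj : ContinuousOn (fun x => (M x).adjugate) s :=
    (Continuous.matrix_adjugate continuous_id).comp_continuousOn hM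
  exact (hdet.inv₀ h0).smul hadj

lemma hasDerivAt_det_lineMap (M N : Matrix m m ℝ) {t : ℝ}
    (h0 : ((1 - t) • M + t • N).det ≠ 0) :
    HasDerivAt (fun s : ℝ => ((1 - s) • M + s • N).det)
      (((1 - t) • M + t • N).det * (((1 - t) • M + t • N)⁻¹ * (N - M)).trace) t := by
  set P := (1 - t) • M + t • N with hP
  obtain ⟨q, hq⟩ : ∃ q : Polynomial ℝ, ∀ r : ℝ, (1 + r • (P⁻¹ * (N - M))).det =
      1 + (P⁻¹ * (N - M)).trace * r + q.eval r * r ^ 2 := ⟨_, fun r => det_one_add_smul r _⟩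
  have key : ∀ s : ℝ, ((1 - s) • M + s • N).det = P.det + (s - t) *
      (P.det * ((P⁻¹ * (N - M)).trace + q.eval (s - t) * (s - t))) := fun s => by
    have : (1 - s) • M + s • N = P * (1 + (s - t) • (P⁻¹ * (N - M))) := by
      rw [lineMap_eq_add_smul M N s t, mul_add, mul_one, mul_smul_comm,
        mul_nonsing_inv_cancel_left _ _ h0.isUnit]
    rw [this, det_mul, hq]
    ring
  have := hasDerivAt_of_eq_add_sub_mul (t := t) (g := fun s : ℝ => ((1 - s) • M + s • N).det)
    (h := fun s => P.det * ((P⁻¹ * (N - M)).trace + q.eval (s - t) * (s - t)))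
    (.of_forall key) (by fun_prop)
  simpa using this

lemma hasDerivAt_trace_inv_lineMap_mul (M N D : Matrix m m ℝ) {t : ℝ}
    (h0 : ((1 - t) • M + t • N).det ≠ 0) :
    HasDerivAt (fun s : ℝ => (((1 - s) • M + s • N)⁻¹ * D).trace)
      (-(((1 - t) • M + t • N)⁻¹ * (N - M) * ((1 - t) • M + t • N)⁻¹ * D).trace) t := by
  have hc : Continuous fun s : ℝ => (1 - s) • M + s • N := by fun_prop
  have hopen : IsOpen {s : ℝ | ((1 - s) • M + s • N).det ≠ 0} :=
    isOpen_ne_fun hc.matrix_det continuous_const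
  have hinv := (ContinuousOn.matrix_inv hc.continuousOn fun s hs => hs).continuousAt
    (hopen.mem_nhds h0)
  have h := hasDerivAt_of_eq_add_sub_mul (t := t)
    (g := fun s : ℝ => (((1 - s) • M + s • N)⁻¹ * D).trace)
    (h := fun s => -(((1 - s) • M + s • N)⁻¹ * (N - M) * ((1 - t) • M + t • N)⁻¹ * D).trace)
    ?_ ?_
  · exact h
  · filter_upwards [hopen.mem_nhds h0] with s hs
    have hs' : ((1 - s) • M + s • N).det ≠ 0 := hs
    have key : ((1 - s) • M + s • N)⁻¹ = ((1 - t) • M + t • N)⁻¹ -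
        (s - t) • (((1 - s) • M + s • N)⁻¹ * (N - M) * ((1 - t) • M + t • N)⁻¹) := by
      have hst := lineMap_eq_add_smul M N s t
      set Q := (1 - s) • M + s • N
      set P := (1 - t) • M + t • N
      have : (s - t) • (N - M) = Q - P := by rw [hst]; abel
      rw [← smul_mul_assoc, ← mul_smul_comm, this, mul_sub, sub_mul,
        nonsing_inv_mul _ hs'.isUnit, mul_assoc, mul_nonsing_inv _ h0.isUnit]
      simp
    conv_lhs => rw [key]
    rw [sub_mul, trace_sub, smul_mul_assoc, trace_smul, smul_eq_mul]
    ring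
  · have : Continuous fun B : Matrix m m ℝ =>
        -(B * (N - M) * ((1 - t) • M + t • N)⁻¹ * D).trace := by fun_prop
    exact this.continuousAt.comp hinv

open scoped MatrixOrder in
lemma trace_inv_mul_mul_inv_mul_nonneg {P D : Matrix m m ℝ} (hP : P.PosDef)
    (hD : D.IsHermitian) : 0 ≤ (P⁻¹ * D * P⁻¹ * D).trace := by
  obtain ⟨B, hB⟩ := CStarAlgebra.nonneg_iff_eq_star_mul_self.mp hP.inv.posSemidef.nonneg
  rw [star_eq_conjTranspose] at hB
  have h := (posSemidef_conjTranspose_mul_self (B * D * Bᴴ)).trace_nonneg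
  have e : (B * D * Bᴴ)ᴴ * (B * D * Bᴴ) = B * (D * Bᴴ * B * D * Bᴴ) := by
    simp only [conjTranspose_mul, conjTranspose_conjTranspose, hD.eq, mul_assoc]
  rw [e, trace_mul_comm] at h
  rw [hB, trace_mul_comm]
  simpa only [mul_assoc] using h

end MatrixPath

section Hessian

variable {n : ℕ}

lemma ContDiff.pd {f : (Fin n → ℝ) → ℝ} (hf : ContDiff ℝ (⊤ : ℕ∞) f) (i : Fin n) :
    ContDiff ℝ (⊤ : ℕ∞) (pd i f) :=
  (hf.fderiv_right (m := (⊤ : ℕ∞)) (by simp)).clm_apply contDiff_const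

lemma continuous_hess {f : (Fin n → ℝ) → ℝ} (hf : ContDiff ℝ (⊤ : ℕ∞) f) :
    Continuous (hess f) :=
  continuous_matrix fun i j => ((hf.pd j).pd i).continuous

lemma pd_linear_comb {f g : (Fin n → ℝ) → ℝ} (hf : ContDiff ℝ (⊤ : ℕ∞) f)
    (hg : ContDiff ℝ (⊤ : ℕ∞) g) (a b : ℝ) (i : Fin n) :
    pd i (fun y => a * f y + b * g y) = fun y => a * pd i f y + b * pd i g y := by
  funext x
  have hf' := ((hf.differentiable (by simp)) x).hasFDerivAt
  have hg' := ((hg.differentiable (by simp)) x).hasFDerivAt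
  have := ((hf'.const_mul a).add (hg'.const_mul b)).fderiv
  simp only [pd]
  erw [this]
  simp

lemma hess_linear_comb {f g : (Fin n → ℝ) → ℝ} (hf : ContDiff ℝ (⊤ : ℕ∞) f)
    (hg : ContDiff ℝ (⊤ : ℕ∞) g) (a b : ℝ) (x : Fin n → ℝ) :
    hess (fun y => a * f y + b * g y) x = a • hess f x + b • hess g x := by
  ext i j
  simp [hess, pd_linear_comb hf hg, pd_linear_comb (hf.pd j) (hg.pd j)]

end Hessian

theorem mabuchi_functional_convex {n : ℕ} (A φ₀ φ₁ : (Fin n → ℝ) → ℝ)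
    (hA : ContDiff ℝ (⊤ : ℕ∞) A) (hAper : ZPer A)
    (hφ₀ : ContDiff ℝ (⊤ : ℕ∞) φ₀) (hφ₁ : ContDiff ℝ (⊤ : ℕ∞) φ₁)
    (hper₀ : ZPer φ₀) (hper₁ : ZPer φ₁)
    (hpos₀ : ∀ x, (hess (fun y => (1 / 2 : ℝ) * ∑ i, y i ^ 2 + φ₀ y) x).PosDef)
    (hpos₁ : ∀ x, (hess (fun y => (1 / 2 : ℝ) * ∑ i, y i ^ 2 + φ₁ y) x).PosDef)
    (F : ℝ → ℝ)
    (hF : ∀ t, F t = ∫ x in Set.Icc (0 : Fin n → ℝ) 1,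
      (-Real.log ((hess (fun y => (1 / 2 : ℝ) * ∑ i, y i ^ 2 +
          ((1 - t) * φ₀ y + t * φ₁ y)) x).det) +
        A x * ((1 - t) * φ₀ x + t * φ₁ x))) :
    (∀ t ∈ Set.Icc (0 : ℝ) 1,
      deriv (deriv F) t =
        ∫ x in Set.Icc (0 : Fin n → ℝ) 1,
          ∑ i, ∑ j, ∑ a, ∑ b,
            (hess (fun y => (1 / 2 : ℝ) * ∑ i, y i ^ 2 +
                ((1 - t) * φ₀ y + t * φ₁ y)) x)⁻¹ i a *
              hess (fun y => φ₁ y - φ₀ y) x a b *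
              (hess (fun y => (1 / 2 : ℝ) * ∑ i, y i ^ 2 +
                ((1 - t) * φ₀ y + t * φ₁ y)) x)⁻¹ b j *
              hess (fun y => φ₁ y - φ₀ y) x i j ∧
      0 ≤ ∫ x in Set.Icc (0 : Fin n → ℝ) 1,
          ∑ i, ∑ j, ∑ a, ∑ b,
            (hess (fun y => (1 / 2 : ℝ) * ∑ i, y i ^ 2 +
                ((1 - t) * φ₀ y + t * φ₁ y)) x)⁻¹ i a *
              hess (fun y => φ₁ y - φ₀ y) x a b *
              (hess (fun y => (1 / 2 : ℝ) * ∑ i, y i ^ 2 +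
                ((1 - t) * φ₀ y + t * φ₁ y)) x)⁻¹ b j *
              hess (fun y => φ₁ y - φ₀ y) x i j) ∧
    ConvexOn ℝ (Set.Icc (0 : ℝ) 1) F := by
  set u₀ : (Fin n → ℝ) → ℝ := fun y => (1 / 2 : ℝ) * ∑ i, y i ^ 2 + φ₀ y with hu₀
  set u₁ : (Fin n → ℝ) → ℝ := fun y => (1 / 2 : ℝ) * ∑ i, y i ^ 2 + φ₁ y with hu₁
  have su₀ : ContDiff ℝ (⊤ : ℕ∞) u₀ := by fun_prop
  have su₁ : ContDiff ℝ (⊤ : ℕ∞) u₁ := by fun_prop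
  have hu : ∀ t x, hess (fun y => (1 / 2 : ℝ) * ∑ i, y i ^ 2 +
      ((1 - t) * φ₀ y + t * φ₁ y)) x = (1 - t) • hess u₀ x + t • hess u₁ x := fun t x => by
    rw [← hess_linear_comb su₀ su₁]
    congr 1
    funext y
    simp only [hu₀, hu₁]
    ring
  have hψ : ∀ x, hess (fun y => φ₁ y - φ₀ y) x = hess u₁ x - hess u₀ x := fun x => by
    have h := hess_linear_comb su₁ su₀ 1 (-1) x
    rw [one_smul, neg_one_smul, ← sub_eq_add_neg] at h
    rw [← h]
    congr 1
    funext y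
    simp only [hu₀, hu₁]
    ring
  have hsymm : ∀ x, (hess u₁ x - hess u₀ x).IsHermitian := fun x =>
    (hpos₁ x).isHermitian.sub (hpos₀ x).isHermitian
  have hpos : ∀ t ∈ Set.Icc (0 : ℝ) 1, ∀ x,
      ((1 - t) • hess u₀ x + t • hess u₁ x).PosDef := fun t ht x => by
    rcases ht.1.eq_or_lt with rfl | h
    · simpa using hpos₀ x
    · exact .posSemidef_add ((hpos₀ x).posSemidef.smul (sub_nonneg.2 ht.2)) ((hpos₁ x).smul h)
  have hc₀ := continuous_hess su₀
  have hc₁ := continuous_hess su₁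
  simp only [hu] at hF
  simp only [hu, hψ, sum_mul_mul_mul_eq_trace (hsymm _)]
  set K : Set (Fin n → ℝ) := Set.Icc 0 1
  have hK : IsCompact K := isCompact_Icc
  set H : ℝ × (Fin n → ℝ) → Matrix (Fin n) (Fin n) ℝ :=
    fun p => (1 - p.1) • hess u₀ p.2 + p.1 • hess u₁ p.2 with hH
  have hHc : Continuous H := by fun_prop
  have hHdet : Continuous fun p => (H p).det := hHc.matrix_det
  set S : Set ℝ := {t | ∀ x ∈ K, (H (t, x)).det ≠ 0} with hSdef
  have hS : IsOpen S := isOpen_iff_mem_nhds.2 fun t ht =>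
    hK.eventually_forall_of_forall_eventually fun x hx =>
      hHdet.continuousAt.eventually_ne (ht x hx)
  have hIS : Set.Icc (0 : ℝ) 1 ⊆ S := fun t ht x _ => (hpos t ht x).det_pos.ne'
  have hne : ∀ p ∈ S ×ˢ K, (H p).det ≠ 0 := fun p hp => hp.1 p.2 hp.2
  have hinv : ContinuousOn (fun p => (H p)⁻¹) (S ×ˢ K) :=
    hHc.continuousOn.matrix_inv hne
  have hDc : Continuous fun p : ℝ × (Fin n → ℝ) => hess u₁ p.2 - hess u₀ p.2 := by fun_prop
  have htr : Continuous (trace : Matrix (Fin n) (Fin n) ℝ → ℝ) :=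
    Continuous.matrix_trace continuous_id
  have hlc : ContinuousOn (fun p : ℝ × (Fin n → ℝ) => -Real.log (H p).det +
      A p.2 * ((1 - p.1) * φ₀ p.2 + p.1 * φ₁ p.2)) (S ×ˢ K) := by
    have := hA.continuous
    have := hφ₀.continuous
    have := hφ₁.continuous
    exact (hHdet.continuousOn.log hne).neg.add (by fun_prop)
  have hlc₁ : ContinuousOn (fun p : ℝ × (Fin n → ℝ) =>
      -((H p)⁻¹ * (hess u₁ p.2 - hess u₀ p.2)).trace + A p.2 * (φ₁ p.2 - φ₀ p.2))
      (S ×ˢ K) := by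
    have := hA.continuous
    have := hφ₀.continuous
    have := hφ₁.continuous
    exact (htr.comp_continuousOn (hinv.mul hDc.continuousOn)).neg.add (by fun_prop)
  have hlc₂ : ContinuousOn (fun p : ℝ × (Fin n → ℝ) => ((H p)⁻¹ * (hess u₁ p.2 - hess u₀ p.2) *
      (H p)⁻¹ * (hess u₁ p.2 - hess u₀ p.2)).trace) (S ×ˢ K) :=
    htr.comp_continuousOn
      (((hinv.mul hDc.continuousOn).mul hinv).mul hDc.continuousOn)
  have hd₁ : ∀ t ∈ S, HasDerivAt F (∫ x in K,
      (-((H (t, x))⁻¹ * (hess u₁ x - hess u₀ x)).trace + A x * (φ₁ x - φ₀ x))) t := by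
    intro t ht
    rw [show F = _ from funext hF]
    refine hasDerivAt_setIntegral_of_continuousOn hS hK hlc (f' := fun t x =>
      -((H (t, x))⁻¹ * (hess u₁ x - hess u₀ x)).trace + A x * (φ₁ x - φ₀ x)) hlc₁ (fun s hs x hx => ?_) ht
    have h := (hasDerivAt_det_lineMap (hess u₀ x) (hess u₁ x) (hs x hx)).log (hs x hx)
    rw [mul_div_cancel_left₀ _ (hs x hx)] at h
    have hl : HasDerivAt (fun s : ℝ => A x * ((1 - s) * φ₀ x + s * φ₁ x))
        (A x * (φ₁ x - φ₀ x)) s := by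
      have h' := ((((hasDerivAt_id s).const_sub 1).mul_const (φ₀ x)).add
        ((hasDerivAt_id s).mul_const (φ₁ x))).const_mul (A x)
      exact h'.congr_deriv (by ring)
    exact h.neg.add hl
  have hd₂ : ∀ t ∈ S, HasDerivAt (deriv F) (∫ x in K,
      ((H (t, x))⁻¹ * (hess u₁ x - hess u₀ x) * (H (t, x))⁻¹ *
        (hess u₁ x - hess u₀ x)).trace) t := by
    intro t ht
    have hev : deriv F =ᶠ[nhds t] fun t => ∫ x in K,
        (-((H (t, x))⁻¹ * (hess u₁ x - hess u₀ x)).trace + A x * (φ₁ x - φ₀ x)) := by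
      filter_upwards [hS.mem_nhds ht] with s hs using (hd₁ s hs).deriv
    refine HasDerivAt.congr_of_eventuallyEq ?_ hev
    refine hasDerivAt_setIntegral_of_continuousOn hS hK (f := fun t x =>
      -((H (t, x))⁻¹ * (hess u₁ x - hess u₀ x)).trace + A x * (φ₁ x - φ₀ x))
      (f' := fun t x => ((H (t, x))⁻¹ * (hess u₁ x - hess u₀ x) * (H (t, x))⁻¹ *
        (hess u₁ x - hess u₀ x)).trace) hlc₁ hlc₂ (fun s hs x hx => ?_) ht
    have h := (hasDerivAt_trace_inv_lineMap_mul (hess u₀ x) (hess u₁ x)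
      (hess u₁ x - hess u₀ x) (hs x hx)).neg.add_const (A x * (φ₁ x - φ₀ x))
    rw [neg_neg] at h
    exact h
  have hnonneg : ∀ t ∈ Set.Icc (0 : ℝ) 1, 0 ≤ ∫ x in K,
      ((H (t, x))⁻¹ * (hess u₁ x - hess u₀ x) * (H (t, x))⁻¹ *
        (hess u₁ x - hess u₀ x)).trace := fun t ht =>
    integral_nonneg fun x => trace_inv_mul_mul_inv_mul_nonneg (hpos t ht x) (hsymm x)
  refine ⟨fun t ht => ⟨(hd₂ t (hIS ht)).deriv, hnonneg t ht⟩, ?_⟩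
  refine convexOn_of_deriv2_nonneg' (convex_Icc 0 1)
    (fun t ht => (hd₁ t (hIS ht)).differentiableAt.differentiableWithinAt)
    (fun t ht => (hd₂ t (hIS ht)).differentiableAt.differentiableWithinAt) fun t ht => ?_
  change 0 ≤ deriv (deriv F) t
  rw [(hd₂ t (hIS ht)).deriv]
  exact hnonneg t ht
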